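/- Let ε ∈ (0,1) and let f : ℝ^{n×p} → ℝ be differentiable with Frobenius gradient ∇f. Suppose X⋆ ∈ ℝ^{n×p} satisfies X⋆ᵀX⋆ = I_p and skew(∇f(X⋆)X⋆ᵀ) = 0, that ‖∇f(X⋆)‖_F ≤ L₀, and that ‖∇f(Z) − ∇f(W)‖_F ≤ L₁‖Z − W‖_F for all Z, W ∈ St(p,n)^ε. Then for every X ∈ St(p,n)^ε, ‖skew(∇f(X)Xᵀ)‖_F ≤ (√(1+ε)·L₁ + L₀)·‖X − X⋆‖_F. -/

import Mathlib

open Matrix BigOperators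

attribute [local instance] Matrix.frobeniusNormedAddCommGroup Matrix.frobeniusNormedSpace

noncomputable section

/-- Skew-symmetric part of a square matrix. -/
def skewPart {m : ℕ} (A : Matrix (Fin m) (Fin m) ℝ) : Matrix (Fin m) (Fin m) ℝ :=
  (1 / 2 : ℝ) • (A - Aᵀ)

theorem frobenius_norm_sq_eq_sum {m n : ℕ} (A : Matrix (Fin m) (Fin n) ℝ) :
    ‖A‖ ^ 2 = ∑ i, ∑ j, A i j ^ 2 := by
  have h : 0 ≤ ∑ i, ∑ j, A i j ^ 2 :=
    Finset.sum_nonneg fun i _ => Finset.sum_nonneg fun j _ => sq_nonneg _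
  rw [Matrix.frobenius_norm_def, ← Real.sqrt_eq_rpow]
  simp only [Real.rpow_two, Real.norm_eq_abs, sq_abs]
  exact Real.sq_sqrt h

theorem trace_mul_transpose_eq_sum {m n : ℕ} (A B : Matrix (Fin m) (Fin n) ℝ) :
    (A * Bᵀ).trace = ∑ i, ∑ j, A i j * B i j := by
  simp [Matrix.trace, Matrix.mul_apply]

theorem frobenius_norm_sq_eq_trace {m n : ℕ} (A : Matrix (Fin m) (Fin n) ℝ) :
    ‖A‖ ^ 2 = (A * Aᵀ).trace := by
  rw [frobenius_norm_sq_eq_sum, trace_mul_transpose_eq_sum]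
  simp only [sq]

/-- The Cauchy–Schwarz inequality for the Frobenius inner product. -/
theorem trace_mul_transpose_le {m n : ℕ} (A B : Matrix (Fin m) (Fin n) ℝ) :
    (A * Bᵀ).trace ≤ ‖A‖ * ‖B‖ := by
  refine le_of_abs_le (abs_le_of_sq_le_sq ?_ (by positivity))
  rw [mul_pow, frobenius_norm_sq_eq_sum, frobenius_norm_sq_eq_sum, trace_mul_transpose_eq_sum]
  simp only [← Fintype.sum_prod_type']
  exact Finset.sum_mul_sq_le_sq_mul_sq _ _ _

/-- If `XᵀX` is within `ε` of the identity, right multiplication by `Xᵀ` enlarges the Frobenius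
norm by a factor of at most `√(1 + ε)`. -/
theorem frobenius_norm_mul_transpose_le {m n p : ℕ} {ε : ℝ} (D : Matrix (Fin m) (Fin p) ℝ)
    (X : Matrix (Fin n) (Fin p) ℝ) (hX : ‖Xᵀ * X - 1‖ ≤ ε) :
    ‖D * Xᵀ‖ ≤ Real.sqrt (1 + ε) * ‖D‖ := by
  have hε : 0 ≤ 1 + ε := by linarith [norm_nonneg (Xᵀ * X - 1)]
  refine le_of_abs_le (abs_le_of_sq_le_sq ?_ (by positivity))
  have hsplit : D * Xᵀ * (D * Xᵀ)ᵀ = D * Dᵀ + D * (Xᵀ * X - 1) * Dᵀ := by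
    simp only [Matrix.transpose_mul, Matrix.transpose_transpose, Matrix.mul_sub, Matrix.sub_mul,
      Matrix.mul_one, Matrix.mul_assoc]
    abel
  have hD : ‖D * (Xᵀ * X - 1)‖ ≤ ‖D‖ * ε :=
    (Matrix.frobenius_norm_mul _ _).trans (mul_le_mul_of_nonneg_left hX (norm_nonneg D))
  rw [frobenius_norm_sq_eq_trace, hsplit, Matrix.trace_add, ← frobenius_norm_sq_eq_trace,
    mul_pow, Real.sq_sqrt hε]
  nlinarith [trace_mul_transpose_le (D * (Xᵀ * X - 1)) D,
    mul_le_mul_of_nonneg_right hD (norm_nonneg D)]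

theorem norm_skewPart_le {m : ℕ} (A : Matrix (Fin m) (Fin m) ℝ) : ‖skewPart A‖ ≤ ‖A‖ := by
  have h := norm_sub_le A Aᵀ
  rw [Matrix.frobenius_norm_transpose] at h
  rw [skewPart, norm_smul, Real.norm_of_nonneg (by norm_num)]
  linarith

theorem skewPart_add {m : ℕ} (A B : Matrix (Fin m) (Fin m) ℝ) :
    skewPart (A + B) = skewPart A + skewPart B := by
  simp only [skewPart, Matrix.transpose_add, ← smul_add]
  congr 1
  abel

/-- Near a stationary point, `‖skew(∇f(X)Xᵀ)‖_F ≤ (√(1+ε)L₁ + L₀)‖X − X⋆‖_F` on the safe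
region `St(p,n)^ε`. Matrices carry the Frobenius norm. -/
theorem skew_gradient_bound {n p : ℕ} (ε L₀ L₁ : ℝ) (hε : ε ∈ Set.Ioo (0 : ℝ) 1)
    (f : Matrix (Fin n) (Fin p) ℝ → ℝ)
    (Gf : Matrix (Fin n) (Fin p) ℝ → Matrix (Fin n) (Fin p) ℝ)
    (hf : Differentiable ℝ f)
    (hG : ∀ X V, fderiv ℝ f X V = Matrix.trace ((Gf X)ᵀ * V))
    (Xs : Matrix (Fin n) (Fin p) ℝ)
    (hXs : Xsᵀ * Xs = 1)
    (hstat : skewPart (Gf Xs * Xsᵀ) = 0)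
    (hL0 : ‖Gf Xs‖ ≤ L₀)
    (hL1 : ∀ Z W : Matrix (Fin n) (Fin p) ℝ, ‖Zᵀ * Z - 1‖ ≤ ε → ‖Wᵀ * W - 1‖ ≤ ε →
      ‖Gf Z - Gf W‖ ≤ L₁ * ‖Z - W‖) :
    ∀ X : Matrix (Fin n) (Fin p) ℝ, ‖Xᵀ * X - 1‖ ≤ ε →
      ‖skewPart (Gf X * Xᵀ)‖ ≤ (Real.sqrt (1 + ε) * L₁ + L₀) * ‖X - Xs‖ := by
  intro X hX
  have hXs' : ‖Xsᵀ * Xs - 1‖ ≤ ε := by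
    rw [hXs, sub_self, norm_zero]
    exact hε.1.le
  have hsplit : Gf X * Xᵀ = (Gf X - Gf Xs) * Xᵀ + Gf Xs * (X - Xs)ᵀ + Gf Xs * Xsᵀ := by
    simp only [Matrix.transpose_sub, Matrix.sub_mul, Matrix.mul_sub]
    abel
  rw [hsplit, skewPart_add, hstat, add_zero]
  calc ‖skewPart ((Gf X - Gf Xs) * Xᵀ + Gf Xs * (X - Xs)ᵀ)‖
      ≤ ‖(Gf X - Gf Xs) * Xᵀ‖ + ‖Gf Xs * (X - Xs)ᵀ‖ :=
        (norm_skewPart_le _).trans (norm_add_le _ _)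
    _ ≤ Real.sqrt (1 + ε) * ‖Gf X - Gf Xs‖ + ‖Gf Xs‖ * ‖X - Xs‖ := by
        refine add_le_add (frobenius_norm_mul_transpose_le _ _ hX) ?_
        have h := Matrix.frobenius_norm_mul (Gf Xs) (X - Xs)ᵀ
        rwa [Matrix.frobenius_norm_transpose] at h
    _ ≤ Real.sqrt (1 + ε) * (L₁ * ‖X - Xs‖) + L₀ * ‖X - Xs‖ :=
        add_le_add (mul_le_mul_of_nonneg_left (hL1 X Xs hX hXs') (Real.sqrt_nonneg _))
          (mul_le_mul_of_nonneg_right hL0 (norm_nonneg _))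
    _ = (Real.sqrt (1 + ε) * L₁ + L₀) * ‖X - Xs‖ := by ring
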